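/- Let V be a nonempty set such that the true lacuna L = L(V) = {Q ∈ W_E : (10Q) ∩ E = (90Q) ∩ E = V} is nonempty, and suppose L is bounded, i.e., U_L = ⋃{Q : Q ∈ L} has finite diameter. Then there exists a cube Q^L ∈ L with diam Q^L = max{diam K : K ∈ L}. Moreover, diam Q^L, diam U_L, and dist(V, E∖V) are pairwise comparable up to absolute multiplicative constants, and V ∪ U_L ⊆ γQ^L for an absolute constant γ. -/

import Mathlib

open scoped ENNReal

noncomputable section

/-- The cube `Q(c,r)` in `ℝⁿ` with the uniform norm: the closed ball of center `c = Q.1` and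
radius `r = Q.2`.  A cube is encoded by the pair `Q = (c, r)`. -/
def cube {n : ℕ} (Q : (Fin n → ℝ) × ℝ) : Set (Fin n → ℝ) :=
  Metric.closedBall Q.1 Q.2

/-- The dilation `λQ = Q(c, λr)` of the cube `Q = (c, r)`. -/
def dilate {n : ℕ} (l : ℝ) (Q : (Fin n → ℝ) × ℝ) : Set (Fin n → ℝ) :=
  Metric.closedBall Q.1 (l * Q.2)

/-- Extended distance between two sets: `dist(A, B) = inf {‖a - b‖ : a ∈ A, b ∈ B}`, with the
convention that it equals `+∞` if one of the sets is empty. -/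
def eSetDist {n : ℕ} (A B : Set (Fin n → ℝ)) : ℝ≥0∞ :=
  ⨅ a ∈ A, ⨅ b ∈ B, edist a b

/-- `W` is a Whitney covering of `ℝⁿ ∖ E`: a countable family of pairwise non-overlapping
cubes whose union is `ℝⁿ ∖ E` and such that `diam Q ≤ dist(Q, E) ≤ 4 diam Q` for all
`Q ∈ W`. -/
structure IsWhitney {n : ℕ} (E : Set (Fin n → ℝ)) (W : Set ((Fin n → ℝ) × ℝ)) : Prop where
  countable : W.Countable
  radius_pos : ∀ Q ∈ W, 0 < Q.2
  nonoverlap : ∀ Q ∈ W, ∀ Q' ∈ W, Q ≠ Q' →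
    Disjoint (interior (cube Q)) (interior (cube Q'))
  union_eq : (⋃ Q ∈ W, cube Q) = Eᶜ
  diam_le_dist : ∀ Q ∈ W, EMetric.diam (cube Q) ≤ eSetDist (cube Q) E
  dist_le_diam : ∀ Q ∈ W, eSetDist (cube Q) E ≤ 4 * EMetric.diam (cube Q)

/-- The true lacuna associated with a set `V`:
`L(V) = {Q ∈ W : (10Q) ∩ E = (90Q) ∩ E = V}`. -/
def lacuna {n : ℕ} (E : Set (Fin n → ℝ)) (W : Set ((Fin n → ℝ) × ℝ))
    (V : Set (Fin n → ℝ)) : Set ((Fin n → ℝ) × ℝ) :=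
  {Q ∈ W | dilate 10 Q ∩ E = V ∧ dilate 90 Q ∩ E = V}

lemma ediam_cube {n : ℕ} [Nonempty (Fin n)] {Q : (Fin n → ℝ) × ℝ} (hQ : 0 ≤ Q.2) :
    EMetric.diam (cube Q) = ENNReal.ofReal (2 * Q.2) := by
  rw [← Metric.diam_closedBall_eq Q.1 hQ, Metric.diam,
    ENNReal.ofReal_toReal Metric.isBounded_closedBall.ediam_ne_top]
  rfl

lemma ofReal_le_eSetDist_iff {n : ℕ} {A B : Set (Fin n → ℝ)} {d : ℝ} :
    ENNReal.ofReal d ≤ eSetDist A B ↔ ∀ a ∈ A, ∀ b ∈ B, d ≤ dist a b := by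
  simp only [eSetDist, le_iInf_iff, edist_dist, ENNReal.ofReal_le_ofReal_iff dist_nonneg]

lemma exists_dist_lt_of_eSetDist_lt {n : ℕ} {A B : Set (Fin n → ℝ)} {d : ℝ}
    (h : eSetDist A B < ENNReal.ofReal d) : ∃ a ∈ A, ∃ b ∈ B, dist a b < d := by
  contrapose! h
  exact ofReal_le_eSetDist_iff.2 h

namespace IsWhitney

variable {n : ℕ} {E : Set (Fin n → ℝ)} {W : Set ((Fin n → ℝ) × ℝ)}
  {Q K : (Fin n → ℝ) × ℝ}

lemma two_mul_radius_le_dist [Nonempty (Fin n)] (hW : IsWhitney E W) (hQ : Q ∈ W)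
    {x e : Fin n → ℝ} (hx : x ∈ cube Q) (he : e ∈ E) : 2 * Q.2 ≤ dist x e := by
  have h := hW.diam_le_dist Q hQ
  rw [ediam_cube (hW.radius_pos Q hQ).le] at h
  exact ofReal_le_eSetDist_iff.1 h x hx e he

lemma exists_dist_lt [Nonempty (Fin n)] (hW : IsWhitney E W) (hQ : Q ∈ W) {t : ℝ}
    (ht : 8 * Q.2 < t) : ∃ y ∈ cube Q, ∃ e ∈ E, dist y e < t := by
  have hr := hW.radius_pos Q hQ
  have h := hW.dist_le_diam Q hQ
  have h4 : (4 : ℝ≥0∞) = ENNReal.ofReal 4 := by simp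
  rw [ediam_cube hr.le, h4, ← ENNReal.ofReal_mul (by norm_num)] at h
  refine exists_dist_lt_of_eSetDist_lt (h.trans_lt ?_)
  rw [ENNReal.ofReal_lt_ofReal_iff (by linarith)]
  linarith

lemma eq_of_dist_lt (hW : IsWhitney E W) (hQ : Q ∈ W) (hK : K ∈ W)
    (h : dist Q.1 K.1 < Q.2) : Q = K := by
  by_contra hne
  refine (hW.nonoverlap Q hQ K hK hne).notMem_of_mem_left (a := K.1) ?_ ?_
  · exact Metric.ball_subset_interior_closedBall (by rwa [Metric.mem_ball, dist_comm])
  · exact Metric.ball_subset_interior_closedBall (Metric.mem_ball_self (hW.radius_pos K hK))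

/-- Only finitely many cubes of a subfamily with bounded union have radius bounded below. -/
lemma finite_setOf_le_radius (hW : IsWhitney E W) {L : Set ((Fin n → ℝ) × ℝ)} (hL : L ⊆ W)
    (hb : Bornology.IsBounded (⋃ Q ∈ L, cube Q)) {ρ : ℝ} (hρ : 0 < ρ) :
    {Q ∈ L | ρ ≤ Q.2}.Finite := by
  obtain ⟨t, ht, hcov⟩ := Metric.totallyBounded_iff.1
    (Metric.isCompact_of_isClosed_isBounded isClosed_closure hb.closure).totallyBounded
    (ρ / 2) (by linarith)
  refine (ht.biUnion (t := fun y ↦ {Q ∈ L | ρ ≤ Q.2 ∧ dist Q.1 y < ρ / 2})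
    fun y _ ↦ Set.Subsingleton.finite ?_).subset ?_
  · rintro Q ⟨hQ, hQρ, hQy⟩ K ⟨hK, -, hKy⟩
    refine hW.eq_of_dist_lt (hL hQ) (hL hK) ?_
    linarith [dist_triangle_right Q.1 K.1 y]
  · rintro Q ⟨hQ, hQρ⟩
    have hc : Q.1 ∈ ⋃ K ∈ L, cube K := Set.mem_biUnion hQ
      (Metric.mem_closedBall_self (hρ.le.trans hQρ))
    obtain ⟨y, hy, hQy⟩ := Set.mem_iUnion₂.1 (hcov (subset_closure hc))
    exact Set.mem_biUnion hy ⟨hQ, hQρ, hQy⟩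

lemma exists_max_radius (hW : IsWhitney E W) {L : Set ((Fin n → ℝ) × ℝ)} (hL : L ⊆ W)
    (hne : L.Nonempty) (hb : Bornology.IsBounded (⋃ Q ∈ L, cube Q)) :
    ∃ Q ∈ L, ∀ K ∈ L, K.2 ≤ Q.2 := by
  obtain ⟨Q₀, hQ₀⟩ := hne
  obtain ⟨Q, ⟨hQ, hQ₀Q⟩, hmax⟩ := Set.exists_max_image _ Prod.snd
    (hW.finite_setOf_le_radius hL hb (hW.radius_pos Q₀ (hL hQ₀))) ⟨Q₀, hQ₀, le_rfl⟩
  refine ⟨Q, hQ, fun K hK ↦ ?_⟩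
  rcases le_total Q₀.2 K.2 with h | h
  · exact hmax K ⟨hK, h⟩
  · exact h.trans hQ₀Q

/-- If `V` is very far from `E \ V` relative to the size of a cube of the lacuna of `V`, then the
lacuna contains a strictly larger cube. -/
lemma exists_radius_lt [Nonempty (Fin n)] (hW : IsWhitney E W) {V : Set (Fin n → ℝ)}
    (hV : V.Nonempty) (hQ : Q ∈ lacuna E W V)
    (hfar : ∀ v ∈ V, ∀ e ∈ E \ V, 100000 * Q.2 ≤ dist v e) :
    ∃ K ∈ lacuna E W V, Q.2 < K.2 := by
  obtain ⟨hQW, hQ10, -⟩ := hQ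
  obtain ⟨v, hv⟩ := hV
  have hr := hW.radius_pos Q hQW
  have hVE : V ⊆ E := hQ10 ▸ Set.inter_subset_right
  have hVQ : V ⊆ dilate 10 Q := hQ10 ▸ Set.inter_subset_left
  have hdV : ∀ a ∈ V, ∀ b ∈ V, dist a b ≤ 20 * Q.2 := fun a ha b hb ↦ by
    have h1 : dist a Q.1 ≤ 10 * Q.2 := hVQ ha
    have h2 : dist b Q.1 ≤ 10 * Q.2 := hVQ hb
    linarith [dist_triangle_right a b Q.1]
  set x : Fin n → ℝ := v + fun _ ↦ 990 * Q.2 with hx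
  have hxv : dist x v = 990 * Q.2 := by
    rw [hx, dist_eq_norm, add_sub_cancel_left, pi_norm_const, Real.norm_of_nonneg (by linarith)]
  have hxE : ∀ e ∈ E, 970 * Q.2 ≤ dist x e := fun e he ↦ by
    by_cases heV : e ∈ V
    · linarith [dist_triangle_right x v e, hdV v hv e heV]
    · linarith [dist_triangle_left v e x, hfar v hv e ⟨he, heV⟩]
  have hxc : x ∈ ⋃ K ∈ W, cube K := by
    rw [hW.union_eq]
    intro h
    have := hxE x h
    rw [dist_self] at this
    linarith
  obtain ⟨K, hKW, hxK⟩ := Set.mem_iUnion₂.1 hxc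
  have hKx : dist x K.1 ≤ K.2 := hxK
  have hup : 2 * K.2 ≤ 990 * Q.2 := hxv ▸ hW.two_mul_radius_le_dist hKW hxK (hVE hv)
  have hK0 := hW.radius_pos K hKW
  obtain ⟨y, hyK, e, heE, hye⟩ := hW.exists_dist_lt hKW (t := 8.5 * K.2) (by linarith)
  have hyc : dist y K.1 ≤ K.2 := hyK
  have hlow : 970 * Q.2 ≤ 10.5 * K.2 := by
    linarith [hxE e heE, dist_triangle x K.1 e, dist_triangle_left K.1 e y]
  have hKv : dist v K.1 ≤ 12 * K.2 := by
    linarith [dist_triangle_left v K.1 x]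
  have h90 : dilate 90 K ∩ E ⊆ V := by
    rintro z ⟨hzK, hzE⟩
    by_contra hzV
    have hz : dist z K.1 ≤ 90 * K.2 := hzK
    linarith [hfar v hv z ⟨hzE, hzV⟩, dist_triangle_right v z K.1]
  have hKe : dist e K.1 ≤ 9.5 * K.2 := by linarith [dist_triangle_left e K.1 y]
  have heV : e ∈ V := h90 ⟨hKe.trans (by linarith), heE⟩
  have h10 : V ⊆ dilate 10 K := fun z hz ↦ by
    change dist z K.1 ≤ 10 * K.2
    linarith [dist_triangle z e K.1, hdV z hz e heV]
  have hsub : dilate 10 K ⊆ dilate 90 K := Metric.closedBall_subset_closedBall (by linarith)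
  exact ⟨K, ⟨hKW,
    ((Set.inter_subset_inter_left E hsub).trans h90).antisymm (Set.subset_inter h10 hVE),
    h90.antisymm (Set.subset_inter (h10.trans hsub) hVE)⟩, by linarith⟩

end IsWhitney

/-- If the true lacuna `L = L(V)` of a nonempty set `V` is nonempty and bounded (i.e. the
union `U_L` of its cubes has finite diameter), then there is a cube `Q^L ∈ L` of maximal
diameter; moreover `diam Q^L`, `diam U_L` and `dist(V, E∖V)` are pairwise comparable up to an
absolute constant `C`, and `V ∪ U_L ⊆ γ Q^L` for an absolute constant `γ`. -/
theorem stmt5 :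
    ∃ (C : ℝ≥0∞) (γ : ℝ), 0 < C ∧ C ≠ ⊤ ∧ 1 ≤ γ ∧
      ∀ (n : ℕ) (E : Set (Fin n → ℝ)) (W : Set ((Fin n → ℝ) × ℝ)),
        E.Nonempty → IsClosed E → IsWhitney E W →
        ∀ V : Set (Fin n → ℝ), V.Nonempty → (lacuna E W V).Nonempty →
        EMetric.diam (⋃ Q ∈ lacuna E W V, cube Q) ≠ ⊤ →
        ∃ QL ∈ lacuna E W V,
          (∀ K ∈ lacuna E W V, EMetric.diam (cube K) ≤ EMetric.diam (cube QL)) ∧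
          EMetric.diam (cube QL) ≤ C * EMetric.diam (⋃ Q ∈ lacuna E W V, cube Q) ∧
          EMetric.diam (⋃ Q ∈ lacuna E W V, cube Q) ≤ C * EMetric.diam (cube QL) ∧
          EMetric.diam (⋃ Q ∈ lacuna E W V, cube Q) ≤ C * eSetDist V (E \ V) ∧
          eSetDist V (E \ V) ≤ C * EMetric.diam (⋃ Q ∈ lacuna E W V, cube Q) ∧
          EMetric.diam (cube QL) ≤ C * eSetDist V (E \ V) ∧
          eSetDist V (E \ V) ≤ C * EMetric.diam (cube QL) ∧
          V ∪ (⋃ Q ∈ lacuna E W V, cube Q) ⊆ dilate γ QL := by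
  refine ⟨50000, 21, by norm_num, by norm_num, by norm_num, ?_⟩
  intro n E W hE _ hW V hV hL hbdd
  have hLW : lacuna E W V ⊆ W := fun Q hQ ↦ hQ.1
  have hn : Nonempty (Fin n) := by
    by_contra hn
    rw [not_nonempty_iff] at hn
    obtain ⟨Q, hQ⟩ := hL
    have hQc : Q.1 ∈ ⋃ K ∈ W, cube K := Set.mem_biUnion (hLW hQ)
      (Metric.mem_closedBall_self (hW.radius_pos Q (hLW hQ)).le)
    rw [hW.union_eq] at hQc
    obtain ⟨e, he⟩ := hE
    exact hQc (Subsingleton.elim e Q.1 ▸ he)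
  obtain ⟨Q, hQ, hmax⟩ := hW.exists_max_radius hLW hL
    (Metric.isBounded_iff_ediam_ne_top.2 hbdd)
  have hr := hW.radius_pos Q (hLW hQ)
  have hV10 : ∀ K ∈ lacuna E W V, ∀ v ∈ V, dist v K.1 ≤ 10 * K.2 := fun K hK v hv ↦
    (hK.2.1.symm ▸ hv : v ∈ dilate 10 K ∩ E).1
  have hsub : (⋃ K ∈ lacuna E W V, cube K) ⊆ dilate 21 Q := by
    refine Set.iUnion₂_subset fun K hK z hz ↦ ?_
    obtain ⟨v, hv⟩ := hV
    have hzK : dist z K.1 ≤ K.2 := hz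
    change dist z Q.1 ≤ 21 * Q.2
    linarith [hmax K hK, hV10 K hK v hv, hV10 Q hQ v hv, dist_triangle z K.1 Q.1,
      dist_triangle_left K.1 Q.1 v]
  have hQU : EMetric.diam (cube Q) ≤ EMetric.diam (⋃ K ∈ lacuna E W V, cube K) :=
    Metric.ediam_mono (Set.subset_biUnion_of_mem hQ)
  have hUQ : EMetric.diam (⋃ K ∈ lacuna E W V, cube K) ≤ ENNReal.ofReal (42 * Q.2) := by
    refine (Metric.ediam_mono hsub).trans ?_
    refine (ediam_cube (Q := (Q.1, 21 * Q.2)) (by dsimp only; linarith)).le.trans ?_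
    exact ENNReal.ofReal_le_ofReal (by dsimp only; linarith)
  have hdist : ENNReal.ofReal (42 * Q.2) ≤ eSetDist V (E \ V) := by
    refine ofReal_le_eSetDist_iff.2 fun v hv e he ↦ ?_
    have he90 : ¬ dist e Q.1 ≤ 90 * Q.2 := fun h ↦ he.2 (hQ.2.2 ▸ ⟨h, he.1⟩)
    linarith [hV10 Q hQ v hv, dist_triangle_left e Q.1 v, dist_comm v e]
  have hdistQ : eSetDist V (E \ V) ≤ 50000 * EMetric.diam (cube Q) := by
    have h5 : (50000 : ℝ≥0∞) = ENNReal.ofReal 50000 := by simp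
    rw [ediam_cube hr.le, h5, ← ENNReal.ofReal_mul (by norm_num)]
    by_contra! hlt
    obtain ⟨K, hK, hQK⟩ := hW.exists_radius_lt hV hQ fun v hv e he ↦ by
      linarith [ofReal_le_eSetDist_iff.1 hlt.le v hv e he]
    exact hQK.not_ge (hmax K hK)
  have hself : ∀ a : ℝ≥0∞, a ≤ 50000 * a := fun a ↦ le_mul_of_one_le_left' (by norm_num)
  refine ⟨Q, hQ, fun K hK ↦ ?_, hQU.trans (hself _), ?_, (hUQ.trans hdist).trans (hself _),
    hdistQ.trans (by gcongr), (hQU.trans (hUQ.trans hdist)).trans (hself _), hdistQ,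
    Set.union_subset (fun v hv ↦ ?_) hsub⟩
  · rw [ediam_cube (hW.radius_pos K (hLW hK)).le, ediam_cube hr.le]
    exact ENNReal.ofReal_le_ofReal (by linarith [hmax K hK])
  · exact (hUQ.trans hdist).trans hdistQ
  · exact (hV10 Q hQ v hv).trans (by linarith)
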